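/- Suppose 1 ≤ i* < j* ≤ n, rad(i*,j*) = r*, and c* ≤ i* is a center of G(i*,j*) (i.e., ecc(i*,j*,c*) = r*). Then r* = max( d_P(1,c*), d_P(c*,i*) + λ_{i*} ). -/

import Mathlib

/-- Path distance along `P` between vertices `a` and `b`. -/
noncomputable def dP {X : Type*} [MetricSpace X] (v : ℕ → X) (a b : ℕ) : ℝ :=
  ∑ m ∈ Finset.Ico (min a b) (max a b), dist (v m) (v (m + 1))

/-- Shortest-path distance in the augmented graph `G(i,j)`. -/
noncomputable def dG {X : Type*} [MetricSpace X] (v : ℕ → X) (i j a b : ℕ) : ℝ :=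
  min (dP v a b)
    (min (dP v a i + dist (v i) (v j) + dP v j b)
         (dP v a j + dist (v i) (v j) + dP v i b))

/-- Eccentricity of vertex `c` in `G(i,j)`: `max_{1 ≤ k ≤ n} dG(c,k)`. -/
noncomputable def ecc {X : Type*} [MetricSpace X] (v : ℕ → X) (n i j c : ℕ) : ℝ :=
  sSup ((fun k => dG v i j c k) '' Set.Icc 1 n)

/-- Radius of `G(i,j)`: `min_{1 ≤ c ≤ n} ecc(i,j,c)`. -/
noncomputable def rad {X : Type*} [MetricSpace X] (v : ℕ → X) (n i j : ℕ) : ℝ :=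
  sInf ((fun c => ecc v n i j c) '' Set.Icc 1 n)

/-- Optimal radius: `min_{1 ≤ i ≤ j ≤ n} rad(i,j)`. -/
noncomputable def rstar {X : Type*} [MetricSpace X] (v : ℕ → X) (n : ℕ) : ℝ :=
  sInf {x | ∃ i j : ℕ, 1 ≤ i ∧ i ≤ j ∧ j ≤ n ∧ x = rad v n i j}

/-- `λ_i = min_{i ≤ j ≤ n} max_{i ≤ k ≤ n} dG(i,j)(i,k)`. -/
noncomputable def lam {X : Type*} [MetricSpace X] (v : ℕ → X) (n i : ℕ) : ℝ :=
  sInf ((fun j => sSup ((fun k => dG v i j i k) '' Set.Icc i n)) '' Set.Icc i n)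

/-- `r_i = min_{1 ≤ c ≤ i} max( dP(1,c), dP(c,i) + λ_i )`. -/
noncomputable def rI {X : Type*} [MetricSpace X] (v : ℕ → X) (n i : ℕ) : ℝ :=
  sInf ((fun c => max (dP v 1 c) (dP v c i + lam v n i)) '' Set.Icc 1 i)

section helpers
variable {X : Type*} [MetricSpace X] (v : ℕ → X)

lemma dP_nonneg (a b : ℕ) : 0 ≤ dP v a b := Finset.sum_nonneg fun _ _ => dist_nonneg

lemma dP_comm (a b : ℕ) : dP v a b = dP v b a := by
  unfold dP; rw [min_comm, max_comm]

lemma dP_add {a b c : ℕ} (h : a ≤ b) (h' : b ≤ c) : dP v a c = dP v a b + dP v b c := by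
  unfold dP
  rw [min_eq_left h, max_eq_right h, min_eq_left h', max_eq_right h',
    min_eq_left (h.trans h'), max_eq_right (h.trans h'), Finset.sum_Ico_consecutive _ h h']

lemma dP_self (a : ℕ) : dP v a a = 0 := by simp [dP]

lemma dG_nonneg (i j a b : ℕ) : 0 ≤ dG v i j a b := by
  have := fun a b => dP_nonneg v a b
  have h : 0 ≤ dist (v i) (v j) := dist_nonneg
  unfold dG
  refine le_min (this _ _) (le_min ?_ ?_)
  · linarith [this a i, this j b]
  · linarith [this a j, this i b]

lemma dG_split {c i j k : ℕ} (hc : c ≤ i) (hj : i ≤ j) (hk : i ≤ k) :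
    dG v i j c k = dP v c i + dG v i j i k := by
  unfold dG
  rw [dP_add v hc hk, dP_add v hc hj, ← min_add_add_left, ← min_add_add_left, dP_self]
  congr 2 <;> ring

lemma dG_one {c i j : ℕ} (h1 : 1 ≤ c) (hc : c ≤ i) (hj : i ≤ j) :
    dG v i j c 1 = dP v 1 c := by
  have h : 0 ≤ dist (v i) (v j) := dist_nonneg
  unfold dG
  rw [dP_comm v c 1, dP_comm v j 1, dP_comm v i 1, dP_add v h1 (hc.trans hj), dP_add v h1 hc]
  apply min_eq_left
  refine le_min ?_ ?_
  · linarith [dP_nonneg v c i, dP_nonneg v c j]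
  · linarith [dP_nonneg v c i, dP_nonneg v c j]

lemma bdd (f : ℕ → ℝ) (a b : ℕ) : BddAbove (f '' Set.Icc a b) :=
  ((Set.finite_Icc a b).image f).bddAbove

lemma ecc_eq {n c i j : ℕ} (h1 : 1 ≤ c) (hc : c ≤ i) (hj : i ≤ j) (hn : j ≤ n) :
    ecc v n i j c = max (dP v 1 c)
      (dP v c i + sSup ((fun k => dG v i j i k) '' Set.Icc i n)) := by
  have hin : i ≤ n := hj.trans hn
  unfold ecc
  apply le_antisymm
  · apply csSup_le ((Set.nonempty_Icc.2 (by omega)).image _)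
    rintro _ ⟨k, ⟨hk1, hkn⟩, rfl⟩
    have hle : dG v i j c k ≤ dP v c k := min_le_left _ _
    show dG v i j c k ≤ _
    rcases le_total k c with h | h
    · apply le_max_of_le_left
      rw [dP_add v hk1 h]
      rw [dP_comm v c k] at hle
      linarith [dP_nonneg v 1 k]
    · apply le_max_of_le_right
      rcases le_total k i with h' | h'
      · have : dG v i j i i ≤ sSup ((fun k => dG v i j i k) '' Set.Icc i n) :=
          le_csSup (bdd _ _ _) ⟨i, ⟨le_rfl, hin⟩, rfl⟩
        rw [dP_add v h h']
        linarith [dP_nonneg v k i, dG_nonneg v i j i i]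
      · have : dG v i j i k ≤ sSup ((fun k => dG v i j i k) '' Set.Icc i n) :=
          le_csSup (bdd _ _ _) ⟨k, ⟨h', hkn⟩, rfl⟩
        rw [dG_split v hc hj h']
        linarith
  · apply max_le
    · rw [← dG_one v h1 hc hj]
      exact le_csSup (bdd _ _ _) ⟨1, ⟨le_rfl, by omega⟩, rfl⟩
    · rw [← le_sub_iff_add_le']
      apply csSup_le ((Set.nonempty_Icc.2 hin).image _)
      rintro _ ⟨k, ⟨hk1, hkn⟩, rfl⟩
      rw [le_sub_iff_add_le']
      show dP v c i + dG v i j i k ≤ _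
      rw [← dG_split v hc hj hk1]
      exact le_csSup (bdd _ _ _) ⟨k, ⟨by omega, hkn⟩, rfl⟩

lemma ecc_nonneg (n i j c : ℕ) : 0 ≤ ecc v n i j c := by
  apply Real.sSup_nonneg
  rintro _ ⟨k, _, rfl⟩
  exact dG_nonneg v _ _ _ _

lemma rad_nonneg (n i j : ℕ) : 0 ≤ rad v n i j := by
  apply Real.sInf_nonneg
  rintro _ ⟨k, _, rfl⟩
  exact ecc_nonneg v _ _ _ _

lemma rstar_le {n i j c : ℕ} (h1 : 1 ≤ c) (hc : c ≤ i) (hj : i ≤ j) (hn : j ≤ n) :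
    rstar v n ≤ ecc v n i j c := by
  have ha : rstar v n ≤ rad v n i j := by
    apply csInf_le
    · refine ⟨0, ?_⟩
      rintro _ ⟨i, j, _, _, _, rfl⟩
      exact rad_nonneg v _ _ _
    · exact ⟨i, j, by omega, hj, hn, rfl⟩
  refine ha.trans (csInf_le ((Set.finite_Icc 1 n).image _).bddBelow ?_)
  exact ⟨c, ⟨h1, by omega⟩, rfl⟩

end helpers

/-- if `c* ≤ i*` is a center of an optimal `G(i*,j*)`, then
`r* = max( dP(1,c*), dP(c*,i*) + λ_{i*} )`. -/
theorem stmt_6 {X : Type*} [MetricSpace X] (n : ℕ) (hn : 2 ≤ n) (v : ℕ → X)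
    (hv : Set.InjOn v (Set.Icc 1 n))
    (istar jstar cstar : ℕ)
    (hi : 1 ≤ istar) (hij : istar < jstar) (hjn : jstar ≤ n)
    (hopt : rad v n istar jstar = rstar v n)
    (hc1 : 1 ≤ cstar) (hci : cstar ≤ istar)
    (hcenter : ecc v n istar jstar cstar = rstar v n) :
    rstar v n = max (dP v 1 cstar) (dP v cstar istar + lam v n istar) := by
  apply le_antisymm
  · have hne : ((fun j => sSup ((fun k => dG v istar j istar k) '' Set.Icc istar n)) ''
        Set.Icc istar n).Nonempty := (Set.nonempty_Icc.2 (by omega)).image _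
    obtain ⟨j, ⟨h1, h2⟩, h3⟩ := hne.csInf_mem ((Set.finite_Icc istar n).image _)
    have h3' : sSup ((fun k => dG v istar j istar k) '' Set.Icc istar n) = lam v n istar := h3
    rw [← h3', ← ecc_eq v hc1 hci h1 h2]
    exact rstar_le v hc1 hci h1 h2
  · rw [← hcenter, ecc_eq v hc1 hci hij.le hjn]
    apply max_le_max le_rfl
    gcongr
    exact csInf_le ((Set.finite_Icc istar n).image _).bddBelow ⟨jstar, ⟨hij.le, hjn⟩, rfl⟩
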